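/- arXiv:1610.05202 — 2 statements merged into one kernel-verified Lean document; each statement's English description precedes it below -/
import Mathlib

section
/- For any initial value Θ(0) ∈ ℝ^{n×p}, the sequence defined by Θ(t+1) = (αI + ᾱC)⁻¹ (αP Θ(t) + ᾱ C Θ^loc) converges as t → ∞ to Θ* = ᾱ (I − ᾱ(I − C) − αP)⁻¹ C Θ^loc, the unique global minimizer of Q_mp. -/
open Matrix Finset Filter Topology

lemma sum_ite_lt_eq_half_sum {ι : Type*} [Fintype ι] [LinearOrder ι] (f : ι → ι → ℝ)
    (hsymm : ∀ i j, f i j = f j i) (hdiag : ∀ i, f i i = 0) :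
    (∑ i, ∑ j, if i < j then f i j else 0) = (1 / 2) * ∑ i, ∑ j, f i j := by
  have hsplit : ∀ i j, f i j = (if i < j then f i j else 0) + (if j < i then f j i else 0) := by
    intro i j
    rcases lt_trichotomy i j with h | rfl | h
    · simp [h, h.le]
    · simp [hdiag]
    · simp [h, h.le, hsymm j i]
  have hsum : ∑ i, ∑ j, f i j = (∑ i, ∑ j, if i < j then f i j else 0)
      + ∑ i, ∑ j, if j < i then f j i else 0 := by
    rw [← sum_add_distrib]
    refine sum_congr rfl fun i _ => ?_
    rw [← sum_add_distrib]
    exact sum_congr rfl fun j _ => hsplit i j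
  have hswap : (∑ i, ∑ j, if j < i then f j i else 0) = ∑ i, ∑ j, if i < j then f i j else 0 :=
    sum_comm
  rw [hsum, hswap]
  ring

/-- Second-order expansion of a weighted graph energy around a critical point. -/
lemma graph_energy_eq_add_of_critical {ι : Type*} [Fintype ι] (W : ι → ι → ℝ)
    (hsymm : ∀ i j, W i j = W j i) (m x y l : ι → ℝ)
    (hcrit : ∀ i, ∑ j, W i j * (x i - x j) + m i * (x i - l i) = 0) :
    (1 / 2) * (∑ i, ∑ j, W i j * (y i - y j) ^ 2) + ∑ i, m i * (y i - l i) ^ 2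
      = (1 / 2) * (∑ i, ∑ j, W i j * (x i - x j) ^ 2) + ∑ i, m i * (x i - l i) ^ 2
        + ((1 / 2) * (∑ i, ∑ j, W i j * ((y i - x i) - (y j - x j)) ^ 2)
          + ∑ i, m i * (y i - x i) ^ 2) := by
  have hswap : ∑ i, ∑ j, W i j * (x i - x j) * (y j - x j)
      = - ∑ i, ∑ j, W i j * (x i - x j) * (y i - x i) := by
    rw [sum_comm, ← sum_neg_distrib]
    refine sum_congr rfl fun i _ => ?_
    rw [← sum_neg_distrib]
    refine sum_congr rfl fun j _ => ?_
    rw [hsymm j i]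
    ring
  have hcross : ∑ i, ∑ j, W i j * (x i - x j) * (y i - x i)
      + ∑ i, m i * (x i - l i) * (y i - x i) = 0 := by
    rw [← sum_add_distrib]
    refine sum_eq_zero fun i _ => ?_
    rw [← sum_mul, ← add_mul, hcrit i, zero_mul]
  have hedge : ∑ i, ∑ j, W i j * (y i - y j) ^ 2
      = ∑ i, ∑ j, W i j * (x i - x j) ^ 2
        + ∑ i, ∑ j, W i j * ((y i - x i) - (y j - x j)) ^ 2
        + 2 * ∑ i, ∑ j, W i j * (x i - x j) * (y i - x i)
        - 2 * ∑ i, ∑ j, W i j * (x i - x j) * (y j - x j) := by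
    simp only [mul_sum, ← sum_add_distrib, ← sum_sub_distrib]
    refine sum_congr rfl fun i _ => sum_congr rfl fun j _ => ?_
    ring
  have hnode : ∑ i, m i * (y i - l i) ^ 2
      = ∑ i, m i * (x i - l i) ^ 2 + ∑ i, m i * (y i - x i) ^ 2
        + 2 * ∑ i, m i * (x i - l i) * (y i - x i) := by
    simp only [mul_sum, ← sum_add_distrib]
    refine sum_congr rfl fun i _ => ?_
    ring
  linarith

lemma abs_sum_mul_le_of_sum_eq_one {ι : Type*} [Fintype ι] (w e : ι → ℝ) (B : ℝ)
    (hw : ∀ j, 0 ≤ w j) (hsum : ∑ j, w j = 1) (he : ∀ j, |e j| ≤ B) :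
    |∑ j, w j * e j| ≤ B := by
  calc |∑ j, w j * e j| ≤ ∑ j, |w j * e j| := abs_sum_le_sum_abs _ _
    _ ≤ ∑ j, w j * B := sum_le_sum fun j _ => by
        rw [abs_mul, abs_of_nonneg (hw j)]
        exact mul_le_mul_of_nonneg_left (he j) (hw j)
    _ = B := by rw [← sum_mul, hsum, one_mul]

lemma sum_weight_pos_of_connected {n : ℕ} (hn : 2 ≤ n) (W : Matrix (Fin n) (Fin n) ℝ)
    (hWsymm : ∀ i j, W i j = W j i) (hWnn : ∀ i j, 0 ≤ W i j)
    (hconn : (SimpleGraph.fromRel (fun i j => 0 < W i j)).Connected) (i : Fin n) :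
    0 < ∑ j, W i j := by
  have : Nontrivial (Fin n) := Fin.nontrivial_iff_two_le.mpr hn
  obtain ⟨j, hj⟩ := hconn.preconnected.exists_adj_of_nontrivial i
  have hpos : 0 < W i j := by
    rw [SimpleGraph.fromRel_adj] at hj
    rcases hj.2 with h | h
    · exact h
    · rwa [hWsymm]
  exact sum_pos' (fun k _ => hWnn i k) ⟨j, mem_univ j, hpos⟩

/-- For any initial value `Θ(0)`, the sequence
`Θ(t+1) = (αI + ᾱC)⁻¹ (αP Θ(t) + ᾱ C Θ^loc)` converges to
`Θ* = ᾱ (I − ᾱ(I − C) − αP)⁻¹ C Θ^loc`, the unique global minimizer of `Q_mp`. -/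
theorem model_propagation_iteration_converges
    (n p : ℕ) (hn : 2 ≤ n) (hp : 1 ≤ p)
    (W : Matrix (Fin n) (Fin n) ℝ)
    (hWsymm : ∀ i j, W i j = W j i)
    (hWnn : ∀ i j, 0 ≤ W i j)
    (hWdiag : ∀ i, W i i = 0)
    (hconn : (SimpleGraph.fromRel (fun i j => 0 < W i j)).Connected)
    (D : Matrix (Fin n) (Fin n) ℝ)
    (hD : D = Matrix.diagonal (fun i => ∑ j, W i j))
    (P : Matrix (Fin n) (Fin n) ℝ) (hP : P = D⁻¹ * W)
    (c : Fin n → ℝ) (hc : ∀ i, 0 < c i ∧ c i ≤ 1)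
    (C : Matrix (Fin n) (Fin n) ℝ) (hC : C = Matrix.diagonal c)
    (α : ℝ) (hα : 0 < α ∧ α < 1)
    (Θloc : Matrix (Fin n) (Fin p) ℝ)
    (Q : Matrix (Fin n) (Fin p) ℝ → ℝ)
    (hQ : ∀ Θ, Q Θ = (1/2) *
      ((∑ i, ∑ j, if i < j then W i j * (∑ k, (Θ i k - Θ j k)^2) else 0)
        + ((1-α)/α) * ∑ i, D i i * c i * (∑ k, (Θ i k - Θloc i k)^2)))
    (Θstar : Matrix (Fin n) (Fin p) ℝ)
    (hΘstar : Θstar =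
      (1-α) • ((1 - (1-α) • ((1 : Matrix (Fin n) (Fin n) ℝ) - C) - α • P)⁻¹ * C * Θloc)) :
    (∀ Θseq : ℕ → Matrix (Fin n) (Fin p) ℝ,
      (∀ t, Θseq (t+1) =
        (α • (1 : Matrix (Fin n) (Fin n) ℝ) + (1-α) • C)⁻¹ * (α • (P * Θseq t) + (1-α) • (C * Θloc))) →
      Tendsto Θseq atTop (𝓝 Θstar)) ∧
    ∀ Θ, Θ ≠ Θstar → Q Θstar < Q Θ := by
  obtain ⟨hα0, hα1⟩ := hα
  have hβ : 0 < 1 - α := by linarith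
  have hd := sum_weight_pos_of_connected hn W hWsymm hWnn hconn
  have hDii : ∀ i, D i i = ∑ j, W i j := fun i => by simp [hD]
  have hDinv : D⁻¹ = diagonal (fun i => (∑ j, W i j)⁻¹) := by
    apply inv_eq_right_inv
    rw [hD, diagonal_mul_diagonal, ← diagonal_one]
    congr 1
    funext i
    exact mul_inv_cancel₀ (hd i).ne'
  have hPij : ∀ i j, P i j = (∑ j, W i j)⁻¹ * W i j := fun i j => by
    rw [hP, hDinv, diagonal_mul]
  have hPnn : ∀ i j, 0 ≤ P i j := fun i j => by
    rw [hPij]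
    exact mul_nonneg (inv_nonneg.mpr (hd i).le) (hWnn i j)
  have hPsum : ∀ i, ∑ j, P i j = 1 := fun i => by
    simp only [hPij]
    rw [← mul_sum, inv_mul_cancel₀ (hd i).ne']
  have hPdiag : ∀ i, P i i = 0 := fun i => by rw [hPij, hWdiag, mul_zero]
  have ha : ∀ i, 0 < α + (1 - α) * c i := fun i =>
    add_pos hα0 (mul_pos hβ (hc i).1)
  set M : Matrix (Fin n) (Fin n) ℝ := 1 - (1 - α) • (1 - C) - α • P with hM
  have hM' : M = diagonal (fun i => α + (1 - α) * c i) - α • P := by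
    rw [hM, hC]
    ext i j
    by_cases h : i = j
    · subst h
      simp
      ring
    · simp [h]
  have hMdet : IsUnit M.det := by
    rw [isUnit_iff_ne_zero]
    apply det_ne_zero_of_sum_row_lt_diag
    intro i
    have hoff : ∑ j ∈ univ.erase i, ‖M i j‖ = α := by
      have hnorm : ∀ j ∈ univ.erase i, ‖M i j‖ = α * P i j := fun j hj => by
        have hij : i ≠ j := (ne_of_mem_erase hj).symm
        simp [hM', hij, abs_of_pos hα0, abs_of_nonneg (hPnn i j)]
      rw [sum_congr rfl hnorm, ← mul_sum, sum_erase _ (hPdiag i), hPsum, mul_one]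
    have hdiag : M i i = α + (1 - α) * c i := by simp [hM', hPdiag]
    rw [hoff, hdiag, Real.norm_of_nonneg (ha i).le]
    linarith [mul_pos hβ (hc i).1]
  have hfix : ∀ i k, (α + (1 - α) * c i) * Θstar i k
      = α * ∑ j, P i j * Θstar j k + (1 - α) * (c i * Θloc i k) := by
    have hMΘ : M * Θstar = (1 - α) • (C * Θloc) := by
      rw [hΘstar, Matrix.mul_smul, Matrix.mul_assoc, mul_nonsing_inv_cancel_left _ _ hMdet]
    intro i k
    have h := congrFun (congrFun hMΘ i) k
    rw [hM', hC, Matrix.sub_mul, Matrix.smul_mul] at h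
    simp only [Matrix.sub_apply, Matrix.smul_apply, diagonal_mul, smul_eq_mul] at h
    rw [Matrix.mul_apply] at h
    linarith
  refine ⟨fun Θseq hrec => ?_, fun Θ hne => ?_⟩
  · have hAinv : (α • (1 : Matrix (Fin n) (Fin n) ℝ) + (1 - α) • C)⁻¹
        = diagonal (fun i => (α + (1 - α) * c i)⁻¹) := by
      apply inv_eq_right_inv
      rw [hC, ← diagonal_one, ← diagonal_smul, ← diagonal_smul, diagonal_add,
        diagonal_mul_diagonal]
      congr 1
      funext i
      simpa using mul_inv_cancel₀ (ha i).ne'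
    have herr : ∀ t i k, Θseq (t + 1) i k - Θstar i k
        = (α / (α + (1 - α) * c i)) * ∑ j, P i j * (Θseq t j k - Θstar j k) := by
      intro t i k
      rw [hrec, hAinv, hC, diagonal_mul]
      simp only [Matrix.add_apply, Matrix.smul_apply, diagonal_mul, smul_eq_mul]
      rw [Matrix.mul_apply]
      simp only [mul_sub, sum_sub_distrib]
      have h := hfix i k
      have ha' := (ha i).ne'
      field_simp
      linarith
    have : Nonempty (Fin n) := hconn.nonempty
    obtain ⟨i₀, -, hmin⟩ := exists_min_image univ c univ_nonempty
    set r : ℝ := α / (α + (1 - α) * c i₀) with hr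
    have hr0 : 0 ≤ r := (div_pos hα0 (ha i₀)).le
    have hr1 : r < 1 := by
      rw [hr, div_lt_one (ha i₀)]
      linarith [mul_pos hβ (hc i₀).1]
    have hbound : ∀ k t i, |Θseq t i k - Θstar i k|
        ≤ r ^ t * ∑ j, |Θseq 0 j k - Θstar j k| := by
      intro k t
      induction t with
      | zero =>
        intro i
        rw [pow_zero, one_mul]
        exact single_le_sum (f := fun j => |Θseq 0 j k - Θstar j k|)
          (fun j _ => abs_nonneg _) (mem_univ i)
      | succ t ih =>
        intro i
        have hri : α / (α + (1 - α) * c i) ≤ r :=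
          div_le_div_of_nonneg_left hα0.le (ha i₀)
            (by linarith [mul_le_mul_of_nonneg_left (hmin i (mem_univ i)) hβ.le])
        rw [herr, abs_mul, abs_of_pos (div_pos hα0 (ha i)), pow_succ', mul_assoc]
        exact mul_le_mul hri (abs_sum_mul_le_of_sum_eq_one _ _ _ (hPnn i) (hPsum i) ih)
          (abs_nonneg _) hr0
    refine tendsto_pi_nhds.mpr fun i => tendsto_pi_nhds.mpr fun k => ?_
    rw [tendsto_iff_norm_sub_tendsto_zero]
    refine squeeze_zero (fun t => norm_nonneg _) (fun t => hbound k t i) ?_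
    simpa using (tendsto_pow_atTop_nhds_zero_of_lt_one hr0 hr1).mul_const
      (∑ j, |Θseq 0 j k - Θstar j k|)
  · set m : Fin n → ℝ := fun i => ((1 - α) / α) * (D i i * c i) with hm
    have hmpos : ∀ i, 0 < m i := fun i => by
      have := hd i
      rw [← hDii i] at this
      exact mul_pos (div_pos hβ hα0) (mul_pos this (hc i).1)
    have hQ' : ∀ Y, Q Y = (1 / 2) * ∑ k, ((1 / 2) * (∑ i, ∑ j, W i j * (Y i k - Y j k) ^ 2)
        + ∑ i, m i * (Y i k - Θloc i k) ^ 2) := by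
      intro Y
      rw [hQ, sum_ite_lt_eq_half_sum (fun i j => W i j * ∑ k, (Y i k - Y j k) ^ 2)
        (fun i j => by
          rw [hWsymm i j]
          congr 1
          exact sum_congr rfl fun k _ => by ring)
        (fun i => by simp)]
      rw [sum_add_distrib, ← mul_sum]
      congr 3
      · simp only [mul_sum]
        exact (sum_congr rfl fun i _ => sum_comm).trans sum_comm
      · rw [sum_comm, mul_sum]
        refine sum_congr rfl fun i _ => ?_
        rw [← mul_sum, hm]
        ring
    have hcrit : ∀ k i, ∑ j, W i j * (Θstar i k - Θstar j k)
        + m i * (Θstar i k - Θloc i k) = 0 := by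
      intro k i
      have hPW : ∑ j, W i j * Θstar j k = (∑ j, W i j) * ∑ j, P i j * Θstar j k := by
        rw [mul_sum]
        refine sum_congr rfl fun j _ => ?_
        rw [hPij, ← mul_assoc, mul_inv_cancel_left₀ (hd i).ne']
      have h := hfix i k
      simp only [mul_sub, sum_sub_distrib]
      simp only [hPW, ← sum_mul, hm, hDii]
      field_simp
      linear_combination (∑ j, W i j) * h
    have hgap : Q Θ = Q Θstar + (1 / 2) * ∑ k,
        ((1 / 2) * (∑ i, ∑ j, W i j * ((Θ i k - Θstar i k) - (Θ j k - Θstar j k)) ^ 2)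
          + ∑ i, m i * (Θ i k - Θstar i k) ^ 2) := by
      rw [hQ', hQ', ← mul_add, ← sum_add_distrib]
      congr 1
      exact sum_congr rfl fun k _ => graph_energy_eq_add_of_critical W hWsymm m
        (fun i => Θstar i k) (fun i => Θ i k) (fun i => Θloc i k) (hcrit k)
    have hedge : ∀ k, 0 ≤ (1 / 2) *
        (∑ i, ∑ j, W i j * ((Θ i k - Θstar i k) - (Θ j k - Θstar j k)) ^ 2) := fun k =>
      mul_nonneg (by norm_num) (sum_nonneg fun i _ => sum_nonneg fun j _ =>
        mul_nonneg (hWnn i j) (sq_nonneg _))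
    have hnode : ∀ k i, 0 ≤ m i * (Θ i k - Θstar i k) ^ 2 := fun k i =>
      mul_nonneg (hmpos i).le (sq_nonneg _)
    obtain ⟨i, k, hik⟩ : ∃ i k, Θ i k ≠ Θstar i k := by
      by_contra! h
      exact hne (Matrix.ext h)
    rw [hgap]
    refine lt_add_of_pos_right _ (mul_pos (by norm_num) (sum_pos'
      (fun k _ => add_nonneg (hedge k) (sum_nonneg fun i _ => hnode k i))
      ⟨k, mem_univ k, add_pos_of_nonneg_of_pos (hedge k) (sum_pos' (fun i _ => hnode k i)
        ⟨i, mem_univ i, mul_pos (hmpos i) (sq_pos_of_ne_zero (sub_ne_zero.mpr hik))⟩)⟩))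
end

section
/- The value 1 is not an eigenvalue of Ā; equivalently, the matrix I − Ā ∈ ℝ^{n²×n²} is invertible. -/
open Matrix Finset

/-- The standard basis vector of `ℝ^{n²}` (indexed by pairs, the pair `(i,j)` encoding
coordinate `(i−1)n + j`) with a 1 in coordinate `(i,j)`. -/
def eVec (n : ℕ) (i j : Fin n) : Fin n × Fin n → ℝ :=
  fun q => if q = (i, j) then 1 else 0

/-- The communication matrix `O(i,j) = I + e_i^j(e_j^j − e_i^j)ᵀ + e_j^i(e_i^i − e_j^i)ᵀ`. -/
def Omat (n : ℕ) (i j : Fin n) : Matrix (Fin n × Fin n) (Fin n × Fin n) ℝ :=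
  1 + Matrix.vecMulVec (eVec n i j) (eVec n j j - eVec n i j)
    + Matrix.vecMulVec (eVec n j i) (eVec n i i - eVec n j i)

/-- The `n² × n²` block-diagonal matrix with `n` diagonal blocks equal to `M`. -/
def blockDiag (n : ℕ) (M : Matrix (Fin n) (Fin n) ℝ) :
    Matrix (Fin n × Fin n) (Fin n × Fin n) ℝ :=
  Matrix.of fun q r => if q.1 = r.1 then M q.2 r.2 else 0

/-- The update matrix `U(i,j) = I + (e_i^i(e_i^i)ᵀ + e_j^j(e_j^j)ᵀ)(M_blk − I)`. -/
def Umat (n : ℕ) (M : Matrix (Fin n) (Fin n) ℝ) (i j : Fin n) :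
    Matrix (Fin n × Fin n) (Fin n × Fin n) ℝ :=
  1 + (Matrix.vecMulVec (eVec n i i) (eVec n i i)
      + Matrix.vecMulVec (eVec n j j) (eVec n j j)) * (blockDiag n M - 1)

/-- The diagonal matrix `I^E` with entry `(i,j)` equal to 1 if `(i,j) ∈ E` or `i = j`,
and 0 otherwise (edges are the pairs with `W i j > 0`). -/
noncomputable def IEmat (n : ℕ) (W : Matrix (Fin n) (Fin n) ℝ) :
    Matrix (Fin n × Fin n) (Fin n × Fin n) ℝ :=
  Matrix.diagonal fun q => if 0 < W q.1 q.2 ∨ q.1 = q.2 then 1 else 0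

lemma eVec_dotProduct (n : ℕ) (i j : Fin n) (x : Fin n × Fin n → ℝ) :
    eVec n i j ⬝ᵥ x = x (i, j) := by
  simp [eVec, dotProduct]

lemma Omat_mulVec_apply (n : ℕ) (i j : Fin n) (x : Fin n × Fin n → ℝ) (q : Fin n × Fin n) :
    (Omat n i j *ᵥ x) q = x q + (if q = (i, j) then x (j, j) - x (i, j) else 0)
      + (if q = (j, i) then x (i, i) - x (j, i) else 0) := by
  simp only [Omat, add_mulVec, one_mulVec, vecMulVec_mulVec, sub_dotProduct, eVec_dotProduct]
  simp [eVec]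

lemma blockDiag_mulVec_apply (n : ℕ) (M : Matrix (Fin n) (Fin n) ℝ)
    (x : Fin n × Fin n → ℝ) (k l : Fin n) :
    (blockDiag n M *ᵥ x) (k, l) = ∑ m, M l m * x (k, m) := by
  simp only [_root_.blockDiag, mulVec, dotProduct, of_apply, Fintype.sum_prod_type, ite_mul,
    zero_mul, Finset.sum_ite_irrel, Finset.sum_const_zero]
  simp

lemma Umat_mulVec_apply (n : ℕ) (M : Matrix (Fin n) (Fin n) ℝ) (i j : Fin n)
    (x : Fin n × Fin n → ℝ) (q : Fin n × Fin n) :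
    (Umat n M i j *ᵥ x) q = x q
      + (if q = (i, i) then ∑ m, M i m * x (i, m) - x (i, i) else 0)
      + (if q = (j, j) then ∑ m, M j m * x (j, m) - x (j, j) else 0) := by
  simp only [Umat, add_mulVec, one_mulVec, ← mulVec_mulVec, vecMulVec_mulVec, sub_mulVec,
    eVec_dotProduct, Pi.sub_apply, blockDiag_mulVec_apply, Pi.add_apply]
  simp [eVec, add_assoc]

/-- A nonnegative matrix whose row sums are less than one has no nonzero fixed vector. -/
lemma eq_zero_of_mulVec_eq_self_of_row_sum_lt_one {ι : Type*} [Fintype ι]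
    (M : Matrix ι ι ℝ) (hM : ∀ i j, 0 ≤ M i j) (hsum : ∀ i, ∑ j, M i j < 1)
    (v : ι → ℝ) (hv : M *ᵥ v = v) : v = 0 := by
  cases isEmpty_or_nonempty ι
  · exact Subsingleton.elim _ _
  obtain ⟨k, hk⟩ := Finite.exists_max fun i => |v i|
  have hle : |v k| ≤ (∑ j, M k j) * |v k| := by
    calc |v k| = |∑ j, M k j * v j| := congrArg abs (congrFun hv k).symm
      _ ≤ ∑ j, |M k j * v j| := Finset.abs_sum_le_sum_abs _ _
      _ ≤ ∑ j, M k j * |v k| := by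
        refine Finset.sum_le_sum fun j _ => ?_
        rw [abs_mul, abs_of_nonneg (hM k j)]
        exact mul_le_mul_of_nonneg_left (hk j) (hM k j)
      _ = _ := by rw [Finset.sum_mul]
  have hzero : |v k| = 0 := by nlinarith [abs_nonneg (v k), hsum k]
  funext i
  exact abs_nonpos_iff.mp (hzero ▸ hk i)

/-- The averaged gossip update, evaluated off the diagonal. -/
lemma sum_update_apply_of_ne (n : ℕ) (M : Matrix (Fin n) (Fin n) ℝ) (π : Fin n → Fin n → ℝ)
    (hπsum : ∀ i, ∑ j, π i j = 1) (x : Fin n × Fin n → ℝ) {k l : Fin n} (hkl : k ≠ l) :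
    ∑ i, ∑ j, π i j * (Umat n M i j *ᵥ (Omat n i j *ᵥ x)) (k, l)
      = n * x (k, l) + (π k l + π l k) * (x (l, l) - x (k, l)) := by
  have h : ∀ i j, π i j * (Umat n M i j *ᵥ (Omat n i j *ᵥ x)) (k, l)
      = π i j * x (k, l) + (if k = i then if l = j then π i j * (x (l, l) - x (k, l)) else 0 else 0)
        + (if l = i then if k = j then π i j * (x (l, l) - x (k, l)) else 0 else 0) := by
    intro i j
    rw [Umat_mulVec_apply, Omat_mulVec_apply]
    grind
  simp only [h, Finset.sum_add_distrib, ← Finset.sum_mul, hπsum]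
  simp [Finset.sum_ite_irrel]
  ring

/-- The averaged gossip update, evaluated on the diagonal, for a vector whose communicated
entries agree with the entries of their owners. -/
lemma sum_update_apply_diag (n : ℕ) (M : Matrix (Fin n) (Fin n) ℝ) (π : Fin n → Fin n → ℝ)
    (hπsum : ∀ i, ∑ j, π i j = 1) (hπdiag : ∀ i, π i i = 0) (x : Fin n × Fin n → ℝ)
    (hx : ∀ k l, M k l ≠ 0 → x (k, l) = x (l, l)) (k : Fin n) :
    ∑ i, ∑ j, π i j * (Umat n M i j *ᵥ (Omat n i j *ᵥ x)) (k, k)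
      = n * x (k, k) + (1 + ∑ i, π i k) * (∑ l, M k l * x (l, l) - x (k, k)) := by
  have hO : ∀ i j m, ∑ l, M m l * (Omat n i j *ᵥ x) (m, l) = ∑ l, M m l * x (l, l) := by
    intro i j m
    refine Finset.sum_congr rfl fun l _ => ?_
    by_cases hml : M m l = 0
    · simp [hml]
    · have := hx m l hml
      rw [Omat_mulVec_apply]
      grind
  have h : ∀ i j, π i j * (Umat n M i j *ᵥ (Omat n i j *ᵥ x)) (k, k)
      = π i j * x (k, k) + (if k = i then π i j * (∑ l, M k l * x (l, l) - x (k, k)) else 0)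
        + (if k = j then π i j * (∑ l, M k l * x (l, l) - x (k, k)) else 0) := by
    intro i j
    rw [Umat_mulVec_apply, hO, hO]
    simp only [Omat_mulVec_apply]
    have := hπdiag i
    grind
  simp only [h, Finset.sum_add_distrib, ← Finset.sum_mul, hπsum]
  simp [Finset.sum_ite_irrel, ← Finset.sum_mul, hπsum]
  ring

/-- The value 1 is not an eigenvalue of `Ā`; equivalently, `I − Ā` is invertible. -/
theorem one_not_eigenvalue_Abar
    (n : ℕ) (hn : 2 ≤ n)
    (W : Matrix (Fin n) (Fin n) ℝ)
    (hWsymm : ∀ i j, W i j = W j i)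
    (hWnn : ∀ i j, 0 ≤ W i j)
    (hWdiag : ∀ i, W i i = 0)
    (hconn : (SimpleGraph.fromRel (fun i j => 0 < W i j)).Connected)
    (D : Matrix (Fin n) (Fin n) ℝ)
    (hD : D = Matrix.diagonal (fun i => ∑ j, W i j))
    (P : Matrix (Fin n) (Fin n) ℝ) (hP : P = D⁻¹ * W)
    (c : Fin n → ℝ) (hc : ∀ i, 0 < c i ∧ c i ≤ 1)
    (C : Matrix (Fin n) (Fin n) ℝ) (hC : C = Matrix.diagonal c)
    (α : ℝ) (hα : 0 < α ∧ α < 1)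
    (M : Matrix (Fin n) (Fin n) ℝ)
    (hM : M = (α • (1 : Matrix (Fin n) (Fin n) ℝ) + (1-α) • C)⁻¹ * (α • P))
    (π : Fin n → Fin n → ℝ)
    (hπnn : ∀ i j, 0 ≤ π i j)
    (hπsum : ∀ i, ∑ j, π i j = 1)
    (hπpos : ∀ i j, 0 < π i j ↔ 0 < W i j)
    (Abar : Matrix (Fin n × Fin n) (Fin n × Fin n) ℝ)
    (hAbar : Abar = (1/(n:ℝ)) •
      (IEmat n W * ∑ i, ∑ j, if i = j then 0 else π i j • (Umat n M i j * Omat n i j))) :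
    (1 : ℂ) ∉ spectrum ℂ (Abar.map Complex.ofReal) ∧ IsUnit (1 - Abar) := by
  have hπdiag : ∀ i, π i i = 0 := fun i =>
    le_antisymm (not_lt.mp fun h => by simpa [hWdiag] using (hπpos i i).mp h) (hπnn i i)
  have hdeg : ∀ i, 0 < ∑ j, W i j := by
    intro i
    obtain ⟨j, -, hj⟩ := Finset.exists_lt_of_sum_lt
      (s := Finset.univ) (f := fun _ : Fin n => (0 : ℝ)) (g := π i) (by simp [hπsum])
    exact Finset.sum_pos' (fun j _ => hWnn i j) ⟨j, Finset.mem_univ _, (hπpos i j).mp hj⟩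
  have hden : ∀ i, 0 < α + (1 - α) * c i := fun i =>
    add_pos hα.1 (mul_pos (sub_pos.mpr hα.2) (hc i).1)
  have hDinv : D⁻¹ = Matrix.diagonal fun i => (∑ j, W i j)⁻¹ := by
    refine Matrix.inv_eq_right_inv ?_
    rw [hD, Matrix.diagonal_mul_diagonal, ← Matrix.diagonal_one]
    exact congrArg _ (funext fun i => mul_inv_cancel₀ (hdeg i).ne')
  have hCinv : (α • (1 : Matrix (Fin n) (Fin n) ℝ) + (1 - α) • C)⁻¹
      = Matrix.diagonal fun i => (α + (1 - α) * c i)⁻¹ := by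
    refine Matrix.inv_eq_right_inv ?_
    rw [hC, ← Matrix.diagonal_one, ← Matrix.diagonal_smul, ← Matrix.diagonal_smul,
      Matrix.diagonal_add, Matrix.diagonal_mul_diagonal]
    refine congrArg _ (funext fun i => ?_)
    simpa using mul_inv_cancel₀ (hden i).ne'
  have hMapply : ∀ i j, M i j = (α + (1 - α) * c i)⁻¹ * (α * ((∑ j, W i j)⁻¹ * W i j)) := by
    intro i j
    rw [hM, hCinv, hP, hDinv, Matrix.diagonal_mul, Matrix.smul_apply, Matrix.diagonal_mul,
      smul_eq_mul]
  have hMnn : ∀ i j, 0 ≤ M i j := fun i j => by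
    rw [hMapply]
    have := hden i
    have := hdeg i
    have := hWnn i j
    have := hα.1
    positivity
  have hMsum : ∀ i, ∑ j, M i j < 1 := by
    intro i
    simp only [hMapply, ← Finset.mul_sum]
    rw [inv_mul_cancel₀ (hdeg i).ne', mul_one, inv_mul_lt_one₀ (hden i)]
    linarith [mul_pos (sub_pos.mpr hα.2) (hc i).1]
  have hn0 : (n : ℝ) ≠ 0 := by positivity
  have hunit : IsUnit (1 - Abar) := by
    rw [← Matrix.mulVec_injective_iff_isUnit, ← Matrix.coe_mulVecLin,
      ← LinearMap.ker_eq_bot, LinearMap.ker_eq_bot']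
    intro x hx
    have hfix : Abar *ᵥ x = x := by
      rw [Matrix.mulVecLin_apply, Matrix.sub_mulVec, Matrix.one_mulVec, sub_eq_zero] at hx
      exact hx.symm
    have heq : ∀ q, n * x q = (if 0 < W q.1 q.2 ∨ q.1 = q.2 then 1 else 0) *
        ∑ i, ∑ j, π i j * (Umat n M i j *ᵥ (Omat n i j *ᵥ x)) q := by
      intro q
      have hq := congrFun hfix q
      rw [hAbar, Matrix.smul_mulVec, ← Matrix.mulVec_mulVec, Pi.smul_apply, IEmat,
        Matrix.mulVec_diagonal, smul_eq_mul, Matrix.sum_mulVec, Finset.sum_apply] at hq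
      rw [← hq, ← mul_assoc, mul_one_div_cancel hn0, one_mul]
      congr 1
      refine Finset.sum_congr rfl fun i _ => ?_
      rw [Matrix.sum_mulVec, Finset.sum_apply]
      refine Finset.sum_congr rfl fun j _ => ?_
      split_ifs with hij
      · subst hij
        simp [hπdiag]
      · rw [Matrix.smul_mulVec, ← Matrix.mulVec_mulVec, Pi.smul_apply, smul_eq_mul]
    have hedge : ∀ k l, 0 < W k l → x (k, l) = x (l, l) := by
      intro k l hW
      have hkl : k ≠ l := by
        rintro rfl
        simp [hWdiag] at hW
      have h := heq (k, l)
      rw [if_pos (Or.inl hW), one_mul, sum_update_apply_of_ne n M π hπsum x hkl] at h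
      have hpos : 0 < π k l + π l k := add_pos_of_pos_of_nonneg ((hπpos k l).mpr hW) (hπnn l k)
      have := (mul_eq_zero.mp (left_eq_add.mp h)).resolve_left hpos.ne'
      linarith
    have hdiag : (fun k => x (k, k)) = 0 := by
      refine eq_zero_of_mulVec_eq_self_of_row_sum_lt_one M hMnn hMsum _ (funext fun k => ?_)
      have h := heq (k, k)
      rw [if_pos (Or.inr rfl), one_mul, sum_update_apply_diag n M π hπsum hπdiag x
        (fun k l hkl => hedge k l ((hWnn k l).lt_of_ne' fun h0 => hkl (by simp [hMapply, h0])))]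
        at h
      have hpos : 0 < 1 + ∑ i, π i k :=
        add_pos_of_pos_of_nonneg one_pos (Finset.sum_nonneg fun i _ => hπnn i k)
      exact sub_eq_zero.mp ((mul_eq_zero.mp (left_eq_add.mp h)).resolve_left hpos.ne')
    funext ⟨k, l⟩
    by_cases hW : 0 < W k l
    · exact (hedge k l hW).trans (congrFun hdiag l)
    · by_cases hkl : k = l
      · subst hkl
        exact congrFun hdiag k
      · have h := heq (k, l)
        rw [if_neg (by simp [hW, hkl]), zero_mul] at h
        exact (mul_eq_zero.mp h).resolve_left hn0
  refine ⟨?_, hunit⟩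
  rw [spectrum.notMem_iff, map_one]
  have h := hunit.map (Complex.ofRealHom.mapMatrix (m := Fin n × Fin n))
  rwa [map_sub, map_one] at h
end
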